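/- Consider the problem in ℝ² of minimizing f(x) = x₂ subject to g₁(x) = x₁² − x₂ ≤ 0 and g₂(x) = −x₂ ≤ 0, and let x* = (0, 0). Then the strong second-order necessary condition holds at x*: the strong critical cone is C^S(x*) = { d ∈ ℝ² : d₂ = 0 }, and for every KKT multiplier vector (μ₁, μ₂) ∈ ℝ₊² at x* and every d ∈ C^S(x*), dᵀ(∇²f(x*) + μ₁∇²g₁(x*) + μ₂∇²g₂(x*))d = 2μ₁d₁² ≥ 0. However, the relaxed constant rank constraint qualification fails at x*: the family of gradients {∇g₁(x), ∇g₂(x)} does not have the same rank for every x in any neighborhood of x*. Hence RCRCQ is not a necessary condition for the strong second-order necessary condition to hold. -/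

import Mathlib

open Filter Topology Set

/-- Objective `f(x) = x₂` of the second example problem. -/
def fEx (x : ℝ × ℝ) : ℝ := x.2

/-- First constraint `g₁(x) = x₁² − x₂`. -/
def g1Ex (x : ℝ × ℝ) : ℝ := x.1 ^ 2 - x.2

/-- Second constraint `g₂(x) = −x₂`. -/
def g2Ex (x : ℝ × ℝ) : ℝ := -x.2

/-- The quadratic form `d ↦ dᵀ ∇²φ(x) d` of the Hessian of `φ` at `x`. -/
noncomputable def hessQuad (φ : ℝ × ℝ → ℝ) (x d : ℝ × ℝ) : ℝ :=
  fderiv ℝ (fun y => fderiv ℝ φ y d) x d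

theorem hasFDerivAt_fEx (x : ℝ × ℝ) : HasFDerivAt fEx (ContinuousLinearMap.snd ℝ ℝ ℝ) x :=
  hasFDerivAt_snd

theorem hasFDerivAt_g1Ex (x : ℝ × ℝ) :
    HasFDerivAt g1Ex
      ((2 * x.1) • ContinuousLinearMap.fst ℝ ℝ ℝ - ContinuousLinearMap.snd ℝ ℝ ℝ) x := by
  have h := ((hasFDerivAt_fst (𝕜 := ℝ) (p := x)).pow 2).sub (hasFDerivAt_snd (𝕜 := ℝ) (p := x))
  exact h.congr_fderiv (by simp)

theorem hasFDerivAt_g2Ex (x : ℝ × ℝ) : HasFDerivAt g2Ex (-ContinuousLinearMap.snd ℝ ℝ ℝ) x :=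
  hasFDerivAt_snd.neg

theorem hessQuad_fEx (x d : ℝ × ℝ) : hessQuad fEx x d = 0 := by
  simp [hessQuad, (hasFDerivAt_fEx _).fderiv]

theorem hessQuad_g1Ex (x d : ℝ × ℝ) : hessQuad g1Ex x d = 2 * d.1 ^ 2 := by
  have h : HasFDerivAt (fun y : ℝ × ℝ => 2 * y.1 * d.1 - d.2)
      (d.1 • (2 : ℝ) • ContinuousLinearMap.fst ℝ ℝ ℝ) x :=
    ((hasFDerivAt_fst.const_mul 2).mul_const d.1).sub_const d.2
  have hfun : (fun y => fderiv ℝ g1Ex y d) = fun y : ℝ × ℝ => 2 * y.1 * d.1 - d.2 := by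
    funext y
    simp [(hasFDerivAt_g1Ex y).fderiv]
  rw [hessQuad, hfun, h.fderiv]
  simp
  ring

theorem hessQuad_g2Ex (x d : ℝ × ℝ) : hessQuad g2Ex x d = 0 := by
  simp [hessQuad, (hasFDerivAt_g2Ex _).fderiv]

theorem finrank_span_gradients_of_fst_eq_zero {x : ℝ × ℝ} (hx : x.1 = 0) :
    Module.finrank ℝ (Submodule.span ℝ {fderiv ℝ g1Ex x, fderiv ℝ g2Ex x}) = 1 := by
  have h : fderiv ℝ g1Ex x = fderiv ℝ g2Ex x := by
    simp [(hasFDerivAt_g1Ex x).fderiv, (hasFDerivAt_g2Ex x).fderiv, hx]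
  rw [h, Set.pair_eq_singleton, finrank_span_singleton]
  intro h0
  have := DFunLike.congr_fun h0 ((0, 1) : ℝ × ℝ)
  simp [(hasFDerivAt_g2Ex x).fderiv] at this

theorem finrank_span_gradients_of_fst_ne_zero {x : ℝ × ℝ} (hx : x.1 ≠ 0) :
    Module.finrank ℝ (Submodule.span ℝ {fderiv ℝ g1Ex x, fderiv ℝ g2Ex x}) = 2 := by
  have hli : LinearIndependent ℝ ![fderiv ℝ g1Ex x, fderiv ℝ g2Ex x] := by
    rw [LinearIndependent.pair_iff]
    intro a b hab
    have h₁ := DFunLike.congr_fun hab ((1, 0) : ℝ × ℝ)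
    have h₂ := DFunLike.congr_fun hab ((0, 1) : ℝ × ℝ)
    simp [(hasFDerivAt_g1Ex x).fderiv, (hasFDerivAt_g2Ex x).fderiv, hx] at h₁ h₂
    exact ⟨h₁, by linarith⟩
  have h := finrank_span_eq_card hli
  rwa [Matrix.range_cons_cons_empty, Fintype.card_fin] at h

/-- **Example (RCRCQ is not necessary for SSONC).** For the problem of minimizing
`f(x) = x₂` subject to `g₁(x) = x₁² − x₂ ≤ 0` and `g₂(x) = −x₂ ≤ 0`, at `x✶ = (0,0)`:
the strong critical cone is `{d : d₂ = 0}`; for every KKT multiplier vector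
`(μ₁, μ₂)` and every critical direction `d`, the Lagrangian Hessian quadratic form
equals `2μ₁d₁² ≥ 0` (so SSONC holds); yet the family `{∇g₁(x), ∇g₂(x)}` does not have
constant rank on any neighborhood of `x✶`, i.e. RCRCQ fails at `x✶`. -/
theorem example2_ssonc_holds_rcrcq_fails :
    ({d : ℝ × ℝ | fderiv ℝ g1Ex (0, 0) d ≤ 0 ∧ fderiv ℝ g2Ex (0, 0) d ≤ 0 ∧
        fderiv ℝ fEx (0, 0) d ≤ 0} = {d : ℝ × ℝ | d.2 = 0}) ∧
    (∀ μ₁ μ₂ : ℝ, 0 ≤ μ₁ → 0 ≤ μ₂ →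
      (fderiv ℝ fEx (0, 0) + μ₁ • fderiv ℝ g1Ex (0, 0) +
        μ₂ • fderiv ℝ g2Ex (0, 0) = 0) →
      μ₁ * g1Ex (0, 0) = 0 → μ₂ * g2Ex (0, 0) = 0 →
      ∀ d : ℝ × ℝ, d.2 = 0 →
        hessQuad fEx (0, 0) d + μ₁ * hessQuad g1Ex (0, 0) d +
            μ₂ * hessQuad g2Ex (0, 0) d = 2 * μ₁ * d.1 ^ 2 ∧
        0 ≤ 2 * μ₁ * d.1 ^ 2) ∧
    (∀ U ∈ 𝓝 ((0, 0) : ℝ × ℝ), ¬ ∃ r : ℕ, ∀ x ∈ U,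
      Module.finrank ℝ (Submodule.span ℝ
        {fderiv ℝ g1Ex x, fderiv ℝ g2Ex x}) = r) := by
  refine ⟨?_, ?_, ?_⟩
  · ext d
    simp only [(hasFDerivAt_g1Ex _).fderiv, (hasFDerivAt_g2Ex _).fderiv,
      (hasFDerivAt_fEx _).fderiv, Set.mem_ofPred_eq]
    simp only [mul_zero, zero_smul, zero_sub, _root_.neg_apply,
      ContinuousLinearMap.coe_snd']
    constructor
    · rintro ⟨-, h₂, h₃⟩
      linarith
    · intro h
      simp [h]
  · intro μ₁ μ₂ hμ₁ _ _ _ _ d _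
    rw [hessQuad_fEx, hessQuad_g1Ex, hessQuad_g2Ex]
    exact ⟨by ring, by positivity⟩
  · rintro U hU ⟨r, hr⟩
    obtain ⟨ε, hε, hball⟩ := Metric.mem_nhds_iff.mp hU
    have hmem : ((ε / 2, 0) : ℝ × ℝ) ∈ U := by
      apply hball
      simp [Prod.dist_eq, abs_of_pos hε, hε]
    have h₁ := hr _ (mem_of_mem_nhds hU)
    have h₂ := hr _ hmem
    rw [finrank_span_gradients_of_fst_eq_zero rfl] at h₁
    rw [finrank_span_gradients_of_fst_ne_zero (half_pos hε).ne'] at h₂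
    omega
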